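/- arXiv:2102.02172 — 10 statements merged into one kernel-verified Lean document; each statement's English description precedes it below -/
import Mathlib

section
/- For every c ∈ ℝ⁴, the orbit of c under the subgroup W₂ = ⟨σ₃, σ₄⟩ of GL(4,ℝ) equals the union of the two parametrized families { c + n((n−1)(c₁+c₂) − c₃ + c₄)·e₃ + n((n+1)(c₁+c₂) − c₃ + c₄)·e₄ : n ∈ ℤ even } ∪ { c + (n+1)(n(c₁+c₂) − c₃ + c₄)·e₃ + (n−1)(n(c₁+c₂) − c₃ + c₄)·e₄ : n ∈ ℤ odd }, where e₃, e₄ are the standard basis vectors of ℝ⁴. -/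
open Finset Complex

noncomputable section

/-- The Apollonian reflection as a linear map: it replaces the `i`-th coordinate `xᵢ`
by `2(Σ_{j≠i} xⱼ) − xᵢ = 2(Σ_j xⱼ) − 3xᵢ` and fixes the other coordinates. -/
def sigmaL (i : Fin 4) : (Fin 4 → ℝ) →ₗ[ℝ] (Fin 4 → ℝ) where
  toFun x := Function.update x i (2 * (∑ j, x j) - 3 * x i)
  map_add' x y := by
    funext j
    rcases eq_or_ne j i with h | h
    · subst h; simp [Function.update_self, Finset.sum_add_distrib]; ring
    · simp [Function.update_of_ne h]
  map_smul' r x := by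
    funext j
    rcases eq_or_ne j i with h | h
    · subst h
      simp only [Pi.smul_apply, smul_eq_mul, Function.update_self, RingHom.id_apply]
      rw [← Finset.mul_sum]
      ring
    · simp [Function.update_of_ne h]

lemma sigmaL_invol (i : Fin 4) : Function.Involutive (sigmaL i) := by
  intro x
  funext j
  have hsum : ∑ k, Function.update x i (2 * (∑ j, x j) - 3 * x i) k
      = 3 * (∑ k, x k) - 4 * x i := by
    rw [Finset.sum_update_of_mem (Finset.mem_univ i)]
    have : ∑ k ∈ Finset.univ \ {i}, x k = (∑ k, x k) - x i := by
      rw [Finset.sum_sdiff_eq_sub (Finset.subset_univ _), Finset.sum_singleton]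
    rw [this]; ring
  rcases eq_or_ne j i with h | h
  · subst h
    simp only [sigmaL, LinearMap.coe_mk, AddHom.coe_mk, Function.update_self, hsum]
    ring
  · simp [sigmaL, Function.update_of_ne h]

/-- The Apollonian reflection `σᵢ` as a linear automorphism of `ℝ⁴`. -/
def apSigma (i : Fin 4) : (Fin 4 → ℝ) ≃ₗ[ℝ] (Fin 4 → ℝ) :=
  LinearEquiv.ofInvolutive (sigmaL i) (sigmaL_invol i)

/-- The subgroup `W₂ = ⟨σ₃, σ₄⟩`. -/
def apW2 : Subgroup ((Fin 4 → ℝ) ≃ₗ[ℝ] (Fin 4 → ℝ)) :=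
  Subgroup.closure {apSigma 2, apSigma 3}


/-- The even family. -/
def famE (c : Fin 4 → ℝ) (n : ℝ) : Fin 4 → ℝ :=
  c + (n * ((n - 1) * (c 0 + c 1) - c 2 + c 3)) • (Pi.single 2 1 : Fin 4 → ℝ)
    + (n * ((n + 1) * (c 0 + c 1) - c 2 + c 3)) • (Pi.single 3 1 : Fin 4 → ℝ)

/-- The odd family. -/
def famO (c : Fin 4 → ℝ) (n : ℝ) : Fin 4 → ℝ :=
  c + ((n + 1) * (n * (c 0 + c 1) - c 2 + c 3)) • (Pi.single 2 1 : Fin 4 → ℝ)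
    + ((n - 1) * (n * (c 0 + c 1) - c 2 + c 3)) • (Pi.single 3 1 : Fin 4 → ℝ)

lemma apSigma_app (i : Fin 4) (x : Fin 4 → ℝ) :
    apSigma i x = Function.update x i (2 * (∑ j, x j) - 3 * x i) := rfl

lemma s2E (c : Fin 4 → ℝ) (n : ℝ) : apSigma 2 (famE c n) = famO c (n + 1) := by
  rw [apSigma_app]
  funext j
  fin_cases j <;> simp [famE, famO, Function.update, Fin.sum_univ_four, Pi.single_apply] <;> ring

lemma s3E (c : Fin 4 → ℝ) (n : ℝ) : apSigma 3 (famE c n) = famO c (n - 1) := by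
  rw [apSigma_app]
  funext j
  fin_cases j <;> simp [famE, famO, Function.update, Fin.sum_univ_four, Pi.single_apply] <;> ring

lemma s2O (c : Fin 4 → ℝ) (n : ℝ) : apSigma 2 (famO c n) = famE c (n - 1) := by
  have := s2E c (n - 1)
  rw [sub_add_cancel] at this
  rw [← this]
  exact sigmaL_invol 2 _

lemma s3O (c : Fin 4 → ℝ) (n : ℝ) : apSigma 3 (famO c n) = famE c (n + 1) := by
  have := s3E c (n + 1)
  rw [add_sub_cancel_right] at this
  rw [← this]
  exact sigmaL_invol 3 _

lemma apSigma_inv (i : Fin 4) : (apSigma i)⁻¹ = apSigma i := by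
  rw [inv_eq_iff_mul_eq_one]
  ext1 x
  exact sigmaL_invol i x

lemma step_mem (c : Fin 4 → ℝ) (i : Fin 4) (hi : i = 2 ∨ i = 3) (x : Fin 4 → ℝ)
    (hx : (∃ n : ℤ, Even n ∧ x = famE c n) ∨ (∃ n : ℤ, Odd n ∧ x = famO c n)) :
    (∃ n : ℤ, Even n ∧ apSigma i x = famE c n) ∨
      (∃ n : ℤ, Odd n ∧ apSigma i x = famO c n) := by
  rcases hx with ⟨n, hn, rfl⟩ | ⟨n, hn, rfl⟩ <;> rcases hi with rfl | rfl
  · exact Or.inr ⟨n + 1, hn.add_one, by rw [s2E]; push_cast; rfl⟩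
  · exact Or.inr ⟨n - 1, hn.sub_odd odd_one, by rw [s3E]; push_cast; rfl⟩
  · exact Or.inl ⟨n - 1, hn.sub_odd odd_one, by rw [s2O]; push_cast; rfl⟩
  · exact Or.inl ⟨n + 1, hn.add_one, by rw [s3O]; push_cast; rfl⟩

lemma mem2 : apSigma 2 ∈ apW2 := Subgroup.subset_closure (by simp)
lemma mem3 : apSigma 3 ∈ apW2 := Subgroup.subset_closure (by simp)

lemma famE_mem (c : Fin 4 → ℝ) (k : ℤ) : ∃ w ∈ apW2, w c = famE c (2 * k) := by
  induction k using Int.induction_on with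
  | zero => exact ⟨1, one_mem _, by simp [famE]⟩
  | succ k ih =>
    obtain ⟨w, hw, h⟩ := ih
    refine ⟨apSigma 3 * (apSigma 2 * w), mul_mem mem3 (mul_mem mem2 hw), ?_⟩
    rw [LinearEquiv.mul_apply, LinearEquiv.mul_apply, h, s2E, s3O]
    push_cast; ring_nf
  | pred k ih =>
    obtain ⟨w, hw, h⟩ := ih
    refine ⟨apSigma 2 * (apSigma 3 * w), mul_mem mem2 (mul_mem mem3 hw), ?_⟩
    rw [LinearEquiv.mul_apply, LinearEquiv.mul_apply, h, s3E, s2O]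
    push_cast; ring_nf

lemma orbit_sub (c : Fin 4 → ℝ) (w : (Fin 4 → ℝ) ≃ₗ[ℝ] (Fin 4 → ℝ)) (hw : w ∈ apW2) :
    (∃ n : ℤ, Even n ∧ w c = famE c n) ∨ (∃ n : ℤ, Odd n ∧ w c = famO c n) := by
  induction hw using Subgroup.closure_induction_left with
  | one => exact Or.inl ⟨0, by simp, by simp [famE]⟩
  | mul_left x hx y hy ih =>
    rw [LinearEquiv.mul_apply]
    rcases hx with rfl | rfl
    · exact step_mem c 2 (Or.inl rfl) _ ih
    · exact step_mem c 3 (Or.inr rfl) _ ih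
  | inv_mul_cancel x hx y hy ih =>
    rw [LinearEquiv.mul_apply]
    rcases hx with rfl | rfl <;> rw [apSigma_inv]
    · exact step_mem c 2 (Or.inl rfl) _ ih
    · exact step_mem c 3 (Or.inr rfl) _ ih

/-- The orbit of `c` under `W₂ = ⟨σ₃, σ₄⟩` is the union of two parametrized families. -/
theorem orbit_W2_parametrization (c : Fin 4 → ℝ) :
    {x | ∃ w ∈ apW2, (w : (Fin 4 → ℝ) ≃ₗ[ℝ] (Fin 4 → ℝ)) c = x} =
      {x | ∃ n : ℤ, Even n ∧
          x = c + ((n : ℝ) * (((n : ℝ) - 1) * (c 0 + c 1) - c 2 + c 3)) •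
                (Pi.single 2 1 : Fin 4 → ℝ)
            + ((n : ℝ) * (((n : ℝ) + 1) * (c 0 + c 1) - c 2 + c 3)) •
                (Pi.single 3 1 : Fin 4 → ℝ)} ∪
      {x | ∃ n : ℤ, Odd n ∧
          x = c + (((n : ℝ) + 1) * ((n : ℝ) * (c 0 + c 1) - c 2 + c 3)) •
                (Pi.single 2 1 : Fin 4 → ℝ)
            + (((n : ℝ) - 1) * ((n : ℝ) * (c 0 + c 1) - c 2 + c 3)) •
                (Pi.single 3 1 : Fin 4 → ℝ)} := by
  apply Set.Subset.antisymm
  · rintro x ⟨w, hw, rfl⟩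
    exact orbit_sub c w hw
  · rintro x (⟨n, hn, hx⟩ | ⟨n, hn, hx⟩)
    · obtain ⟨k, rfl⟩ := hn.two_dvd
      obtain ⟨w, hw, h⟩ := famE_mem c k
      refine ⟨w, hw, ?_⟩
      rw [h, hx]
      push_cast; rfl
    · obtain ⟨k, rfl⟩ := hn
      obtain ⟨w, hw, h⟩ := famE_mem c k
      refine ⟨apSigma 2 * w, mul_mem mem2 hw, ?_⟩
      rw [LinearEquiv.mul_apply, h, s2E, hx]
      push_cast; rfl
end
end

section
/- Let c ∈ ℝ⁴ with c₁ + c₂ > 0 and let s ∈ ℂ⁴ with Re(s₃) + Re(s₄) > 0. Set z₊ = ((c₁+c₂+c₃−c₄)s₃ − (c₁+c₂−c₃+c₄)s₄)/(2πi), z₋ = (−(c₁+c₂−c₃+c₄)s₃ + (c₁+c₂+c₃−c₄)s₄)/(2πi), and τ = −(c₁+c₂)(s₃+s₄)/(πi) (so Im τ > 0). Then Σ'_{w ∈ W₂} exp(−⟨w·c, s⟩) = exp(−⟨c,s⟩)·½(θ₀₀(z₊,τ) + θ₀₁(z₊,τ)) + exp(−⟨c,s⟩ + (c₃−c₄)(s₃−s₄))·½(θ₀₀(z₋,τ)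 − θ₀₁(z₋,τ)). -/
open Finset Complex

noncomputable section

/-- The pairing `⟨x,s⟩ = x₁s₁+x₂s₂+x₃s₃+x₄s₄` of a real vector with a complex vector. -/
def pairC (x : Fin 4 → ℝ) (s : Fin 4 → ℂ) : ℂ := ∑ i, (x i : ℂ) * s i

/-- The Jacobi theta function `θ₀₁(z,τ) = Σ_{n∈ℤ} (−1)ⁿ exp(2πinz + πin²τ) = θ₀₀(z+1/2, τ)`. -/
def theta01 (z τ : ℂ) : ℂ := jacobiTheta₂ (z + 1/2) τ

/-- The explicit orbit map. -/
def orbV (n : ℤ) (x : Fin 4 → ℝ) : Fin 4 → ℝ :=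
  if Even n then
    ![x 0, x 1, x 2 + n * (x 2 - x 3) + (x 0 + x 1) * n ^ 2 + (x 0 + x 1) * n,
      x 3 + n * (x 2 - x 3) + (x 0 + x 1) * n ^ 2 - (x 0 + x 1) * n]
  else
    ![x 0, x 1, x 3 - n * (x 2 - x 3) + (x 0 + x 1) * n ^ 2 + (x 0 + x 1) * n,
      x 2 - n * (x 2 - x 3) + (x 0 + x 1) * n ^ 2 - (x 0 + x 1) * n]

lemma apSigma_two (x : Fin 4 → ℝ) :
    apSigma 2 x = ![x 0, x 1, 2 * (x 0 + x 1 + x 3) - x 2, x 3] := by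
  funext j
  change Function.update x 2 (2 * (∑ j, x j) - 3 * x 2) j = _
  rw [Fin.sum_univ_four]
  fin_cases j <;> simp [Function.update]
  ring

lemma apSigma_three (x : Fin 4 → ℝ) :
    apSigma 3 x = ![x 0, x 1, x 2, 2 * (x 0 + x 1 + x 2) - x 3] := by
  funext j
  change Function.update x 3 (2 * (∑ j, x j) - 3 * x 3) j = _
  rw [Fin.sum_univ_four]
  fin_cases j <;> simp [Function.update]
  ring

lemma sigma_two_orbV (n : ℤ) (x : Fin 4 → ℝ) : apSigma 2 (orbV n x) = orbV (1 - n) x := by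
  rw [apSigma_two]
  by_cases h : Even n
  · have h' : ¬ Even (1 - n) := by grind
    simp only [orbV, if_pos h, if_neg h']
    funext j
    fin_cases j <;> simp <;> ring
  · have h' : Even (1 - n) := by grind
    simp only [orbV, if_pos h', if_neg h]
    funext j
    fin_cases j <;> simp <;> ring

lemma sigma_three_orbV (n : ℤ) (x : Fin 4 → ℝ) : apSigma 3 (orbV n x) = orbV (-1 - n) x := by
  rw [apSigma_three]
  by_cases h : Even n
  · have h' : ¬ Even (-1 - n) := by grind
    simp only [orbV, if_pos h, if_neg h']
    funext j
    fin_cases j <;> simp <;> ring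
  · have h' : Even (-1 - n) := by grind
    simp only [orbV, if_pos h', if_neg h]
    funext j
    fin_cases j <;> simp <;> ring

lemma orbV_zero (x : Fin 4 → ℝ) : orbV 0 x = x := by
  funext j
  fin_cases j <;> simp [orbV]

lemma exists_orb (n : ℤ) : ∃ w : apW2, ∀ x, (w : (Fin 4 → ℝ) ≃ₗ[ℝ] (Fin 4 → ℝ)) x = orbV n x := by
  have ha : apSigma 2 ∈ apW2 := Subgroup.subset_closure (by simp)
  have hb : apSigma 3 ∈ apW2 := Subgroup.subset_closure (by simp)
  let P : ℤ → Prop := fun n => ∃ w : apW2, ∀ x,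
    (w : (Fin 4 → ℝ) ≃ₗ[ℝ] (Fin 4 → ℝ)) x = orbV n x
  have hPa : ∀ n, P n → P (1 - n) := by
    rintro n ⟨w, hw⟩
    refine ⟨⟨apSigma 2, ha⟩ * w, fun x => ?_⟩
    rw [← sigma_two_orbV, ← hw]; rfl
  have hPb : ∀ n, P n → P (-1 - n) := by
    rintro n ⟨w, hw⟩
    refine ⟨⟨apSigma 3, hb⟩ * w, fun x => ?_⟩
    rw [← sigma_three_orbV, ← hw]; rfl
  have h0 : P 0 := ⟨1, fun x => by rw [orbV_zero]; rfl⟩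
  have key : P n ∧ P (n + 1) := by
    induction n using Int.induction_on with
    | zero => exact ⟨h0, by simpa using hPa 0 h0⟩
    | succ i ih =>
      refine ⟨ih.2, ?_⟩
      have := hPa _ (hPb _ ih.1)
      convert this using 1; ring
    | pred i ih =>
      refine ⟨?_, by simpa using ih.1⟩
      have := hPb _ (hPa _ ih.2)
      convert this using 1; ring
  exact key.1

lemma orbV_inj {m n : ℤ} (h : ∀ x, orbV m x = orbV n x) : m = n := by
  have h1 := h ![1, 0, 0, 0]
  have h2 := congrFun h1 2
  have h3 := congrFun h1 3
  have e : ∀ k : ℤ, orbV k ![1, 0, 0, 0] 2 - orbV k ![1, 0, 0, 0] 3 = 2 * k := by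
    intro k
    unfold orbV
    split_ifs <;> simp <;> ring
  have em := e m
  rw [h2, h3, e n] at em
  have : (m : ℝ) = n := by linarith
  exact_mod_cast this

lemma orb_surj (w : (Fin 4 → ℝ) ≃ₗ[ℝ] (Fin 4 → ℝ)) (hw : w ∈ apW2) :
    ∃ n : ℤ, ∀ x, w x = orbV n x := by
  have ia : (apSigma 2)⁻¹ = apSigma 2 := by
    rw [inv_eq_iff_mul_eq_one]; ext1 x; exact sigmaL_invol 2 x
  have ib : (apSigma 3)⁻¹ = apSigma 3 := by
    rw [inv_eq_iff_mul_eq_one]; ext1 x; exact sigmaL_invol 3 x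
  have step : ∀ g ∈ ({apSigma 2, apSigma 3} : Set _), ∀ y : (Fin 4 → ℝ) ≃ₗ[ℝ] (Fin 4 → ℝ),
      (∃ n : ℤ, ∀ x, y x = orbV n x) → ∃ n : ℤ, ∀ x, (g * y) x = orbV n x := by
    rintro g hg y ⟨n, hn⟩
    rcases hg with rfl | rfl
    · exact ⟨1 - n, fun x => by rw [← sigma_two_orbV, ← hn]; rfl⟩
    · exact ⟨-1 - n, fun x => by rw [← sigma_three_orbV, ← hn]; rfl⟩
  induction hw using Subgroup.closure_induction_left with
  | one => exact ⟨0, fun x => by rw [orbV_zero]; rfl⟩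
  | mul_left g hg y hy ih => exact step g hg y ih
  | inv_mul_cancel g hg y hy ih =>
    have : g⁻¹ = g := by
      rcases hg with rfl | rfl
      · exact ia
      · exact ib
    rw [this]; exact step g hg y ih

lemma term_half (n : ℤ) (z τ : ℂ) :
    jacobiTheta₂_term n (z + 1 / 2) τ = (if Even n then 1 else -1) * jacobiTheta₂_term n z τ := by
  have e : jacobiTheta₂_term n (z + 1 / 2) τ
      = Complex.exp (Real.pi * Complex.I) ^ n * jacobiTheta₂_term n z τ := by
    rw [← Complex.exp_int_mul]
    unfold jacobiTheta₂_term
    rw [← Complex.exp_add]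
    congr 1; ring
  rw [e, Complex.exp_pi_mul_I]
  split_ifs with h
  · rw [h.neg_one_zpow]
  · rw [(Int.not_even_iff_odd.mp h).neg_one_zpow]

/-- Expansion of the `W₂`-orbit sum `Z₂⁺(s)` in Jacobi theta functions. -/
theorem Z2_plus_theta_expansion (c : Fin 4 → ℝ) (hc : 0 < c 0 + c 1)
    (s : Fin 4 → ℂ) (hs : 0 < (s 2).re + (s 3).re) :
    (∑' w : apW2, Complex.exp (-pairC ((w : (Fin 4 → ℝ) ≃ₗ[ℝ] (Fin 4 → ℝ)) c) s)) =
      Complex.exp (-pairC c s) *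
        ((jacobiTheta₂ ((((c 0 + c 1 + c 2 - c 3 : ℝ) : ℂ) * s 2
              - ((c 0 + c 1 - c 2 + c 3 : ℝ) : ℂ) * s 3) / (2 * (Real.pi : ℂ) * Complex.I))
            (-(((c 0 + c 1 : ℝ) : ℂ) * (s 2 + s 3)) / ((Real.pi : ℂ) * Complex.I))
          + theta01 ((((c 0 + c 1 + c 2 - c 3 : ℝ) : ℂ) * s 2
              - ((c 0 + c 1 - c 2 + c 3 : ℝ) : ℂ) * s 3) / (2 * (Real.pi : ℂ) * Complex.I))
            (-(((c 0 + c 1 : ℝ) : ℂ) * (s 2 + s 3)) / ((Real.pi : ℂ) * Complex.I))) / 2) +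
      Complex.exp (-pairC c s + ((c 2 - c 3 : ℝ) : ℂ) * (s 2 - s 3)) *
        ((jacobiTheta₂ ((-((c 0 + c 1 - c 2 + c 3 : ℝ) : ℂ) * s 2
              + ((c 0 + c 1 + c 2 - c 3 : ℝ) : ℂ) * s 3) / (2 * (Real.pi : ℂ) * Complex.I))
            (-(((c 0 + c 1 : ℝ) : ℂ) * (s 2 + s 3)) / ((Real.pi : ℂ) * Complex.I))
          - theta01 ((-((c 0 + c 1 - c 2 + c 3 : ℝ) : ℂ) * s 2
              + ((c 0 + c 1 + c 2 - c 3 : ℝ) : ℂ) * s 3) / (2 * (Real.pi : ℂ) * Complex.I))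
            (-(((c 0 + c 1 : ℝ) : ℂ) * (s 2 + s 3)) / ((Real.pi : ℂ) * Complex.I))) / 2) := by
  obtain ⟨zp, hzp⟩ : ∃ z : ℂ, z = (((c 0 + c 1 + c 2 - c 3 : ℝ) : ℂ) * s 2
    - ((c 0 + c 1 - c 2 + c 3 : ℝ) : ℂ) * s 3) / (2 * (Real.pi : ℂ) * Complex.I) := ⟨_, rfl⟩
  obtain ⟨zm, hzm⟩ : ∃ z : ℂ, z = (-((c 0 + c 1 - c 2 + c 3 : ℝ) : ℂ) * s 2
    + ((c 0 + c 1 + c 2 - c 3 : ℝ) : ℂ) * s 3) / (2 * (Real.pi : ℂ) * Complex.I) := ⟨_, rfl⟩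
  obtain ⟨τ, hτ⟩ : ∃ z : ℂ, z = -(((c 0 + c 1 : ℝ) : ℂ) * (s 2 + s 3))
    / ((Real.pi : ℂ) * Complex.I) := ⟨_, rfl⟩
  rw [← hzp, ← hzm, ← hτ]
  have hpi : (Real.pi : ℂ) ≠ 0 := by exact_mod_cast Real.pi_ne_zero
  have hI := Complex.I_ne_zero
  have hτim : 0 < τ.im := by
    have e : τ = (((c 0 + c 1) / Real.pi : ℝ) : ℂ) * ((s 2 + s 3) * Complex.I) := by
      rw [hτ]; push_cast; field_simp; rw [Complex.I_sq]; ring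
    rw [e, Complex.im_ofReal_mul, Complex.mul_I_im, Complex.add_re]
    exact mul_pos (div_pos hc Real.pi_pos) hs
  have tp : 2 * Real.pi * Complex.I * zp = ((c 0 + c 1 + c 2 - c 3 : ℝ) : ℂ) * s 2
    - ((c 0 + c 1 - c 2 + c 3 : ℝ) : ℂ) * s 3 := by rw [hzp]; field_simp
  have tm : 2 * Real.pi * Complex.I * zm = -((c 0 + c 1 - c 2 + c 3 : ℝ) : ℂ) * s 2
    + ((c 0 + c 1 + c 2 - c 3 : ℝ) : ℂ) * s 3 := by rw [hzm]; field_simp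
  have tt : Real.pi * Complex.I * τ = -(((c 0 + c 1 : ℝ) : ℂ) * (s 2 + s 3)) := by
    rw [hτ]; field_simp
  have S1 := (Equiv.neg ℤ).hasSum_iff.mpr (hasSum_jacobiTheta₂_term zp hτim)
  have S2 := (Equiv.neg ℤ).hasSum_iff.mpr (hasSum_jacobiTheta₂_term (zp + 1 / 2) hτim)
  have S3 := hasSum_jacobiTheta₂_term zm hτim
  have S4 := hasSum_jacobiTheta₂_term (zm + 1 / 2) hτim
  have S := (((S1.add S2).div_const 2).mul_left (Complex.exp (-pairC c s))).add
    (((S3.sub S4).div_const 2).mul_left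
      (Complex.exp (-pairC c s + ((c 2 - c 3 : ℝ) : ℂ) * (s 2 - s 3))))
  choose G hG using exists_orb
  have hbij : Function.Bijective G := by
    constructor
    · intro m n h
      exact orbV_inj fun x => by rw [← hG, ← hG, h]
    · rintro ⟨w, hw⟩
      obtain ⟨n, hn⟩ := orb_surj w hw
      refine ⟨n, Subtype.ext (LinearEquiv.ext fun x => ?_)⟩
      rw [hG, hn]
  rw [← (Equiv.ofBijective G hbij).tsum_eq]
  refine Eq.trans (tsum_congr fun n => ?_) S.tsum_eq
  simp only [Equiv.ofBijective_apply, hG, Function.comp_apply, Equiv.neg_apply, term_half,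
    even_neg]
  by_cases h : Even n
  · simp only [if_pos h, one_mul, sub_self, zero_div, mul_zero, add_zero, add_self_div_two]
    unfold jacobiTheta₂_term
    rw [← Complex.exp_add]
    congr 1
    have : 2 * Real.pi * Complex.I * ((-n : ℤ) : ℂ) * zp
        + Real.pi * Complex.I * ((-n : ℤ) : ℂ) ^ 2 * τ
        = -n * (2 * Real.pi * Complex.I * zp) + n ^ 2 * (Real.pi * Complex.I * τ) := by
      push_cast; ring
    rw [this, tp, tt]
    simp only [pairC, Fin.sum_univ_four, orbV, if_pos h]
    simp
    ring
  · simp only [if_neg h, neg_mul, one_mul, add_neg_cancel, zero_div, mul_zero, zero_add,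
      sub_neg_eq_add, add_self_div_two]
    unfold jacobiTheta₂_term
    rw [← Complex.exp_add]
    congr 1
    have : 2 * Real.pi * Complex.I * (n : ℂ) * zm
        + Real.pi * Complex.I * (n : ℂ) ^ 2 * τ
        = n * (2 * Real.pi * Complex.I * zm) + n ^ 2 * (Real.pi * Complex.I * τ) := by
      ring
    rw [this, tm, tt]
    simp only [pairC, Fin.sum_univ_four, orbV, if_neg h]
    simp
    ring
end
end

section
/- Let c ∈ ℝ⁴ with c₁ + c₂ > 0 and let s ∈ ℂ⁴ with Re(s₃) + Re(s₄) > 0. Set z₊ = ((c₁+c₂+c₃−c₄)s₃ − (c₁+c₂−c₃+c₄)s₄)/(2πi), z₋ = (−(c₁+c₂−c₃+c₄)s₃ + (c₁+c₂+c₃−c₄)s₄)/(2πi), and τ = −(c₁+c₂)(s₃+s₄)/(πi). Then the signed sum Σ'_{w ∈ W₂} det(w)·exp(−⟨w·c, s⟩) equals exp(−⟨c,s⟩)·½(θ₀₀(z₊,τ) + θ₀₁(z₊,τ)) − exp(−⟨c,s⟩ + (c₃−c₄)(s₃−s₄))·½(θ₀₀(z₋,τ) − θ₀₁(z₋,τ)).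 (Here det(w) = (−1)^{ℓ(w)}, since each generator σ₃, σ₄ has determinant −1.) -/
open Finset Complex

noncomputable section

/-- The orbit map indexed by the integers. -/
def apF (n : ℤ) (x : Fin 4 → ℝ) : Fin 4 → ℝ :=
  if Even n then
    ![x 0, x 1, x 2 - (x 2 - x 3) * n + (x 0 + x 1) * n ^ 2 - (x 0 + x 1) * n,
      x 3 - (x 2 - x 3) * n + (x 0 + x 1) * n ^ 2 + (x 0 + x 1) * n]
  else
    ![x 0, x 1, x 3 - (x 2 - x 3) * n + (x 0 + x 1) * n ^ 2 + (x 0 + x 1) * n,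
      x 2 - (x 2 - x 3) * n + (x 0 + x 1) * n ^ 2 - (x 0 + x 1) * n]

lemma apF_two_even (n : ℤ) (h : Even n) (x) : apSigma 2 (apF n x) = apF (n + 1) x := by
  have h2 : ¬ Even (n + 1) := by simpa [Int.even_add_one] using h
  show Function.update _ _ _ = _
  rw [apF, apF, if_pos h, if_neg h2]
  funext j
  fin_cases j <;> simp [Fin.sum_univ_four, Function.update] <;> ring

lemma apF_two_odd (n : ℤ) (h : ¬ Even n) (x) : apSigma 2 (apF n x) = apF (n - 1) x := by
  have h2 : Even (n - 1) := by simpa [Int.even_sub_one] using h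
  show Function.update _ _ _ = _
  rw [apF, apF, if_neg h, if_pos h2]
  funext j
  fin_cases j <;> simp [Fin.sum_univ_four, Function.update] <;> ring

lemma apF_three_even (n : ℤ) (h : Even n) (x) : apSigma 3 (apF n x) = apF (n - 1) x := by
  have h2 : ¬ Even (n - 1) := by simpa [Int.even_sub_one] using h
  show Function.update _ _ _ = _
  rw [apF, apF, if_pos h, if_neg h2]
  funext j
  fin_cases j <;> simp [Fin.sum_univ_four, Function.update] <;> ring

lemma apF_three_odd (n : ℤ) (h : ¬ Even n) (x) : apSigma 3 (apF n x) = apF (n + 1) x := by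
  have h2 : Even (n + 1) := by simpa [Int.even_add_one] using h
  show Function.update _ _ _ = _
  rw [apF, apF, if_neg h, if_pos h2]
  funext j
  fin_cases j <;> simp [Fin.sum_univ_four, Function.update] <;> ring

lemma apF_zero (x) : apF 0 x = x := by
  funext j
  fin_cases j <;> simp [apF]

lemma apF_inj (m n : ℤ) (h : ∀ x, apF m x = apF n x) : m = n := by
  have h1 := h ![1, 0, 0, 0]
  have h2 := congrFun h1 2
  have h3 := congrFun h1 3
  unfold apF at h2 h3
  split_ifs at h2 h3 with hm hn hn
  · simp at h2 h3
    have : (m : ℝ) = n := by linarith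
    exact_mod_cast this
  · simp at h2 h3
    have : (m : ℝ) = -n := by linarith
    have h4 : m = -n := by exact_mod_cast this
    rw [h4] at hm
    simp at hm
    exact absurd hm hn
  · simp at h2 h3
    have : (m : ℝ) = -n := by linarith
    have h4 : m = -n := by exact_mod_cast this
    rw [h4] at hm
    simp at hm
    exact absurd hn (by simpa using hm)
  · simp at h2 h3
    have : (m : ℝ) = n := by linarith
    exact_mod_cast this

lemma apSigma_det (i : Fin 4) (hi : i = 2 ∨ i = 3) :
    LinearMap.det (apSigma i).toLinearMap = -1 := by
  rw [← LinearMap.det_toMatrix']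
  rcases hi with rfl | rfl
  · have : LinearMap.toMatrix' (apSigma 2).toLinearMap =
        !![1, 0, 0, 0; 0, 1, 0, 0; 2, 2, -1, 2; 0, 0, 0, 1] := by
      ext a b
      rw [LinearMap.toMatrix'_apply]
      show Function.update _ _ _ _ = _
      fin_cases a <;> fin_cases b <;>
        simp [Fin.sum_univ_four, Function.update, Pi.single_apply] <;> norm_num
    rw [this]
    simp [Matrix.det_succ_row_zero, Fin.sum_univ_succ, Fin.succAbove]
  · have : LinearMap.toMatrix' (apSigma 3).toLinearMap =
        !![1, 0, 0, 0; 0, 1, 0, 0; 0, 0, 1, 0; 2, 2, 2, -1] := by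
      ext a b
      rw [LinearMap.toMatrix'_apply]
      show Function.update _ _ _ _ = _
      fin_cases a <;> fin_cases b <;>
        simp [Fin.sum_univ_four, Function.update, Pi.single_apply] <;> norm_num
    rw [this]
    simp [Matrix.det_succ_row_zero, Fin.sum_univ_succ, Fin.succAbove]

/-- sign -/
def apEps (n : ℤ) : ℝ := if Even n then 1 else -1

lemma apEps_add (n : ℤ) : apEps (n + 1) = - apEps n := by
  unfold apEps; simp only [Int.even_add_one]; split_ifs <;> simp_all

lemma apEps_sub (n : ℤ) : apEps (n - 1) = - apEps n := by
  unfold apEps; simp only [Int.even_sub_one]; split_ifs <;> simp_all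

lemma apSigma_mem (i : Fin 4) (h : i = 2 ∨ i = 3) : apSigma i ∈ apW2 :=
  Subgroup.subset_closure (by rcases h with rfl | rfl <;> simp)

lemma exists_step (i : Fin 4) (h : i = 2 ∨ i = 3) (n m : ℤ)
    (hF : ∀ x, apSigma i (apF n x) = apF m x) (he : apEps m = - apEps n)
    (H : ∃ g : apW2, (∀ x, g.1 x = apF n x) ∧ LinearMap.det g.1.toLinearMap = apEps n) :
    ∃ g : apW2, (∀ x, g.1 x = apF m x) ∧ LinearMap.det g.1.toLinearMap = apEps m := by
  obtain ⟨g, h1, h2⟩ := H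
  refine ⟨⟨apSigma i, apSigma_mem i h⟩ * g, fun x => ?_, ?_⟩
  · show apSigma i (g.1 x) = _
    rw [h1, hF]
  · show LinearMap.det ((apSigma i).toLinearMap ∘ₗ g.1.toLinearMap) = _
    rw [LinearMap.det_comp, apSigma_det i h, h2, he]; ring

lemma exists_g (n : ℤ) :
    ∃ g : apW2, (∀ x, g.1 x = apF n x) ∧ LinearMap.det g.1.toLinearMap = apEps n := by
  have hp : ∀ n : ℤ, (∃ g : apW2, (∀ x, g.1 x = apF n x) ∧
      LinearMap.det g.1.toLinearMap = apEps n) → (∃ g : apW2, (∀ x, g.1 x = apF (n + 1) x) ∧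
      LinearMap.det g.1.toLinearMap = apEps (n + 1)) := by
    intro n
    by_cases h : Even n
    · exact exists_step 2 (by simp) _ _ (apF_two_even n h) (apEps_add n)
    · exact exists_step 3 (by simp) _ _ (apF_three_odd n h) (apEps_add n)
  have hm : ∀ n : ℤ, (∃ g : apW2, (∀ x, g.1 x = apF n x) ∧
      LinearMap.det g.1.toLinearMap = apEps n) → (∃ g : apW2, (∀ x, g.1 x = apF (n - 1) x) ∧
      LinearMap.det g.1.toLinearMap = apEps (n - 1)) := by
    intro n
    by_cases h : Even n
    · exact exists_step 3 (by simp) _ _ (apF_three_even n h) (apEps_sub n)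
    · exact exists_step 2 (by simp) _ _ (apF_two_odd n h) (apEps_sub n)
  induction n using Int.induction_on with
  | zero =>
    refine ⟨1, fun x => by rw [apF_zero]; rfl, ?_⟩
    show LinearMap.det (LinearMap.id) = _
    simp [apEps]
  | succ i ih => exact hp _ ih
  | pred i ih => exact hm _ ih

lemma surj_g (w) (hw : w ∈ apW2) : ∃ n : ℤ, ∀ x, w x = apF n x := by
  have key : ∀ i : Fin 4, (i = 2 ∨ i = 3) → ∀ y : (Fin 4 → ℝ) ≃ₗ[ℝ] (Fin 4 → ℝ),
      (∃ n : ℤ, ∀ x, y x = apF n x) → ∃ n : ℤ, ∀ x, (apSigma i * y) x = apF n x := by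
    rintro i hi y ⟨n, hn⟩
    have : ∀ x, (apSigma i * y) x = apSigma i (apF n x) := fun x => by
      rw [← hn]; rfl
    simp only [this]
    rcases hi with rfl | rfl <;> by_cases h : Even n
    · exact ⟨_, apF_two_even n h⟩
    · exact ⟨_, apF_two_odd n h⟩
    · exact ⟨_, apF_three_even n h⟩
    · exact ⟨_, apF_three_odd n h⟩
  have hinv : ∀ i, (apSigma i)⁻¹ = apSigma i := by
    intro i
    rw [inv_eq_iff_mul_eq_one]
    exact LinearEquiv.ext fun x => sigmaL_invol i x
  unfold apW2 at hw
  induction hw using Subgroup.closure_induction_left with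
  | one => exact ⟨0, fun x => by rw [apF_zero]; rfl⟩
  | mul_left x hx y hy ih =>
    rcases hx with rfl | rfl
    · exact key 2 (by simp) y ih
    · exact key 3 (by simp) y ih
  | inv_mul_cancel x hx y hy ih =>
    rcases hx with rfl | rfl
    · rw [hinv]; exact key 2 (by simp) y ih
    · rw [hinv]; exact key 3 (by simp) y ih

lemma half_term (n : ℤ) (z τ : ℂ) :
    jacobiTheta₂_term n (z + 1 / 2) τ = (apEps n : ℂ) * jacobiTheta₂_term n z τ := by
  unfold jacobiTheta₂_term
  have : 2 * (Real.pi : ℂ) * I * n * (z + 1 / 2) + Real.pi * I * n ^ 2 * τ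
    = (n : ℂ) * (Real.pi * I) + (2 * (Real.pi : ℂ) * I * n * z + Real.pi * I * n ^ 2 * τ) := by
    ring
  rw [this, Complex.exp_add, Complex.exp_int_mul, Complex.exp_pi_mul_I]
  congr 1
  unfold apEps
  split_ifs with h
  · simp [h.neg_one_zpow]
  · rw [Int.not_even_iff_odd] at h
    simp [h.neg_one_zpow]

/-- Expansion of the signed `W₂`-orbit sum `Z₂⁻(s)` in Jacobi theta functions; here
`det(w) = (−1)^{ℓ(w)}` since each generator `σ₃, σ₄` has determinant `−1`. -/
theorem Z2_minus_theta_expansion (c : Fin 4 → ℝ) (hc : 0 < c 0 + c 1)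
    (s : Fin 4 → ℂ) (hs : 0 < (s 2).re + (s 3).re) :
    (∑' w : apW2, ((LinearMap.det (w : (Fin 4 → ℝ) ≃ₗ[ℝ] (Fin 4 → ℝ)).toLinearMap : ℝ) : ℂ)
        * Complex.exp (-pairC ((w : (Fin 4 → ℝ) ≃ₗ[ℝ] (Fin 4 → ℝ)) c) s)) =
      Complex.exp (-pairC c s) *
        ((jacobiTheta₂ ((((c 0 + c 1 + c 2 - c 3 : ℝ) : ℂ) * s 2
              - ((c 0 + c 1 - c 2 + c 3 : ℝ) : ℂ) * s 3) / (2 * (Real.pi : ℂ) * Complex.I))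
            (-(((c 0 + c 1 : ℝ) : ℂ) * (s 2 + s 3)) / ((Real.pi : ℂ) * Complex.I))
          + theta01 ((((c 0 + c 1 + c 2 - c 3 : ℝ) : ℂ) * s 2
              - ((c 0 + c 1 - c 2 + c 3 : ℝ) : ℂ) * s 3) / (2 * (Real.pi : ℂ) * Complex.I))
            (-(((c 0 + c 1 : ℝ) : ℂ) * (s 2 + s 3)) / ((Real.pi : ℂ) * Complex.I))) / 2) -
      Complex.exp (-pairC c s + ((c 2 - c 3 : ℝ) : ℂ) * (s 2 - s 3)) *
        ((jacobiTheta₂ ((-((c 0 + c 1 - c 2 + c 3 : ℝ) : ℂ) * s 2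
              + ((c 0 + c 1 + c 2 - c 3 : ℝ) : ℂ) * s 3) / (2 * (Real.pi : ℂ) * Complex.I))
            (-(((c 0 + c 1 : ℝ) : ℂ) * (s 2 + s 3)) / ((Real.pi : ℂ) * Complex.I))
          - theta01 ((-((c 0 + c 1 - c 2 + c 3 : ℝ) : ℂ) * s 2
              + ((c 0 + c 1 + c 2 - c 3 : ℝ) : ℂ) * s 3) / (2 * (Real.pi : ℂ) * Complex.I))
            (-(((c 0 + c 1 : ℝ) : ℂ) * (s 2 + s 3)) / ((Real.pi : ℂ) * Complex.I))) / 2) := by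
  choose g hg hdet using exists_g
  have hbij : Function.Bijective g := by
    constructor
    · intro m n h
      exact apF_inj m n fun x => by rw [← hg, ← hg, h]
    · rintro ⟨w, hw⟩
      obtain ⟨n, hn⟩ := surj_g w hw
      refine ⟨n, Subtype.ext (LinearEquiv.ext fun x => ?_)⟩
      rw [hg, hn]
  rw [← (Equiv.ofBijective g hbij).tsum_eq]
  simp only [Equiv.ofBijective_apply, hg, hdet]
  have hpi : (Real.pi : ℂ) ≠ 0 := by exact_mod_cast Real.pi_ne_zero
  set τ : ℂ := -(((c 0 + c 1 : ℝ) : ℂ) * (s 2 + s 3)) / ((Real.pi : ℂ) * Complex.I) with hτ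
  set zp : ℂ := (((c 0 + c 1 + c 2 - c 3 : ℝ) : ℂ) * s 2
              - ((c 0 + c 1 - c 2 + c 3 : ℝ) : ℂ) * s 3) / (2 * (Real.pi : ℂ) * Complex.I) with hzp
  set zm : ℂ := (-((c 0 + c 1 - c 2 + c 3 : ℝ) : ℂ) * s 2
              + ((c 0 + c 1 + c 2 - c 3 : ℝ) : ℂ) * s 3) / (2 * (Real.pi : ℂ) * Complex.I) with hzm
  have him : 0 < τ.im := by
    have : τ = (((c 0 + c 1) / Real.pi : ℝ) : ℂ) * ((s 2 + s 3) * I) := by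
      rw [hτ]; push_cast; field_simp; simp
    rw [this, Complex.im_ofReal_mul]
    have := div_pos hc Real.pi_pos
    simp only [mul_im, add_re, I_im, I_re]
    exact mul_pos this (by linarith)
  have hτ2 : Real.pi * I * τ = -(((c 0 + c 1 : ℝ) : ℂ) * (s 2 + s 3)) := by
    rw [hτ]; field_simp
  have hzp2 : 2 * Real.pi * I * zp = (((c 0 + c 1 + c 2 - c 3 : ℝ) : ℂ) * s 2
              - ((c 0 + c 1 - c 2 + c 3 : ℝ) : ℂ) * s 3) := by
    rw [hzp]; field_simp
  have hzm2 : 2 * Real.pi * I * zm = (-((c 0 + c 1 - c 2 + c 3 : ℝ) : ℂ) * s 2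
              + ((c 0 + c 1 + c 2 - c 3 : ℝ) : ℂ) * s 3) := by
    rw [hzm]; field_simp
  clear_value τ zp zm
  have a1 := hasSum_jacobiTheta₂_term zp him
  have a2 := hasSum_jacobiTheta₂_term (zp + 1 / 2) him
  have b1 := hasSum_jacobiTheta₂_term zm him
  have b2 := hasSum_jacobiTheta₂_term (zm + 1 / 2) him
  have A := (((a1.add a2).div_const 2).mul_left (Complex.exp (-pairC c s))).sub
    (((b1.sub b2).div_const 2).mul_left
      (Complex.exp (-pairC c s + ((c 2 - c 3 : ℝ) : ℂ) * (s 2 - s 3))))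
  unfold theta01
  rw [← A.tsum_eq]
  refine tsum_congr fun n => ?_
  rw [half_term, half_term]
  by_cases h : Even n
  · have e : apEps n = 1 := by simp [apEps, h]
    rw [e]
    simp only [ofReal_one, one_mul, sub_self, zero_div, mul_zero, sub_zero, add_self_div_two]
    rw [jacobiTheta₂_term, ← Complex.exp_add]
    congr 1
    have : 2 * (Real.pi : ℂ) * I * n * zp + Real.pi * I * n ^ 2 * τ
      = n * (2 * Real.pi * I * zp) + n ^ 2 * (Real.pi * I * τ) := by ring
    rw [this, hτ2, hzp2, apF, if_pos h]
    simp [pairC, Fin.sum_univ_four]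
    ring
  · have e : apEps n = -1 := by simp [apEps, h]
    rw [e]
    have r : ∀ x y p q : ℂ, x * ((p + ((-1 : ℝ) : ℂ) * p) / 2) -
        y * ((q - ((-1 : ℝ) : ℂ) * q) / 2) = ((-1 : ℝ) : ℂ) * (y * q) := by
      intros; push_cast; ring
    rw [r, jacobiTheta₂_term, ← Complex.exp_add]
    congr 2
    have : 2 * (Real.pi : ℂ) * I * n * zm + Real.pi * I * n ^ 2 * τ
      = n * (2 * Real.pi * I * zm) + n ^ 2 * (Real.pi * I * τ) := by ring
    rw [this, hτ2, hzm2, apF, if_neg h]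
    simp [pairC, Fin.sum_univ_four]
    ring
end
end

section
/- Let (a,b,c) ∈ ℤ³. If every element of the orbit of (a,b,c) under the group W₃ = ⟨ρ₁, ρ₂, ρ₃⟩ has all three coordinates nonnegative, then G(a,b,c) ≤ 0. (This is the statement that any vector β in the nonnegative integer span of the simple roots α₂, α₃, α₄ whose full Weyl-orbit stays in the nonnegative span satisfies (β,β) ≤ 0.) -/
open Finset Complex

noncomputable section

/-- The length-squared form `G(a,b,c) = 2(a²+b²+c²) − 4(ab+ac+bc)` of the rank-3
hyperbolic root system `H₇₁⁽³⁾`. -/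
def G3 (x : Fin 3 → ℝ) : ℝ :=
  2 * (x 0 ^ 2 + x 1 ^ 2 + x 2 ^ 2) - 4 * (x 0 * x 1 + x 0 * x 2 + x 1 * x 2)

/-- The reflection replacing the `i`-th coordinate by twice the sum of the others minus it. -/
def rhoL (i : Fin 3) : (Fin 3 → ℝ) →ₗ[ℝ] (Fin 3 → ℝ) where
  toFun x := Function.update x i (2 * (∑ j, x j) - 3 * x i)
  map_add' x y := by
    funext j
    rcases eq_or_ne j i with h | h
    · subst h; simp [Function.update_self, Finset.sum_add_distrib]; ring
    · simp [Function.update_of_ne h]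
  map_smul' r x := by
    funext j
    rcases eq_or_ne j i with h | h
    · subst h
      simp only [Pi.smul_apply, smul_eq_mul, Function.update_self, RingHom.id_apply]
      rw [← Finset.mul_sum]
      ring
    · simp [Function.update_of_ne h]

lemma rhoL_invol (i : Fin 3) : Function.Involutive (rhoL i) := by
  intro x
  funext j
  have hsum : ∑ k, Function.update x i (2 * (∑ j, x j) - 3 * x i) k
      = 3 * (∑ k, x k) - 4 * x i := by
    rw [Finset.sum_update_of_mem (Finset.mem_univ i)]
    have : ∑ k ∈ Finset.univ \ {i}, x k = (∑ k, x k) - x i := by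
      rw [Finset.sum_sdiff_eq_sub (Finset.subset_univ _), Finset.sum_singleton]
    rw [this]; ring
  rcases eq_or_ne j i with h | h
  · subst h
    simp only [rhoL, LinearMap.coe_mk, AddHom.coe_mk, Function.update_self, hsum]
    ring
  · simp [rhoL, Function.update_of_ne h]

/-- The reflection `ρᵢ` as a linear automorphism of `ℝ³`. -/
def apRho (i : Fin 3) : (Fin 3 → ℝ) ≃ₗ[ℝ] (Fin 3 → ℝ) :=
  LinearEquiv.ofInvolutive (rhoL i) (rhoL_invol i)

/-- The group `W₃ = ⟨ρ₁, ρ₂, ρ₃⟩`. -/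
def apW3 : Subgroup ((Fin 3 → ℝ) ≃ₗ[ℝ] (Fin 3 → ℝ)) :=
  Subgroup.closure {apRho 0, apRho 1, apRho 2}

lemma apRho_zero (a b c : ℝ) : apRho 0 ![a, b, c] = ![2 * b + 2 * c - a, b, c] := by
  change Function.update _ _ _ = _
  funext j
  fin_cases j <;> simp [Fin.sum_univ_three, Function.update] <;> ring

lemma apRho_one (a b c : ℝ) : apRho 1 ![a, b, c] = ![a, 2 * a + 2 * c - b, c] := by
  change Function.update _ _ _ = _
  funext j
  fin_cases j <;> simp [Fin.sum_univ_three, Function.update] <;> ring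

lemma apRho_two (a b c : ℝ) : apRho 2 ![a, b, c] = ![a, b, 2 * a + 2 * b - c] := by
  change Function.update _ _ _ = _
  funext j
  fin_cases j <;> simp [Fin.sum_univ_three, Function.update] <;> ring

lemma G3_vec (a b c : ℝ) : G3 ![a, b, c] =
    2 * (a ^ 2 + b ^ 2 + c ^ 2) - 4 * (a * b + a * c + b * c) := by
  simp [G3]

lemma orbit_aux (n : ℕ) : ∀ a b c : ℤ, a + b + c ≤ n →
    (∀ w ∈ apW3, ∀ i : Fin 3,
      0 ≤ (w : (Fin 3 → ℝ) ≃ₗ[ℝ] (Fin 3 → ℝ)) ![(a : ℝ), (b : ℝ), (c : ℝ)] i) →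
    G3 ![(a : ℝ), (b : ℝ), (c : ℝ)] ≤ 0 := by
  induction n with
  | zero =>
    intro a b c hs h
    have ha := h 1 (one_mem _) 0
    have hb := h 1 (one_mem _) 1
    have hc := h 1 (one_mem _) 2
    simp at ha hb hc
    obtain rfl : a = 0 := by push_cast at hs; omega
    obtain rfl : b = 0 := by push_cast at hs; omega
    obtain rfl : c = 0 := by push_cast at hs; omega
    simp [G3]
  | succ n ih =>
    intro a b c hs h
    push_cast at hs
    have ha := h 1 (one_mem _) 0
    have hb := h 1 (one_mem _) 1
    have hc := h 1 (one_mem _) 2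
    simp at ha hb hc
    by_cases h0 : b + c < a
    · have := ih (2 * b + 2 * c - a) b c (by omega) (fun w hw i => by
        have := h (w * apRho 0) (mul_mem hw (Subgroup.subset_closure (by simp))) i
        rw [LinearEquiv.mul_apply, apRho_zero] at this
        push_cast
        exact this)
      push_cast at this
      rw [G3_vec] at this ⊢
      linarith
    by_cases h1 : a + c < b
    · have := ih a (2 * a + 2 * c - b) c (by omega) (fun w hw i => by
        have := h (w * apRho 1) (mul_mem hw (Subgroup.subset_closure (by simp))) i
        rw [LinearEquiv.mul_apply, apRho_one] at this
        push_cast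
        exact this)
      push_cast at this
      rw [G3_vec] at this ⊢
      linarith
    by_cases h2 : a + b < c
    · have := ih a b (2 * a + 2 * b - c) (by omega) (fun w hw i => by
        have := h (w * apRho 2) (mul_mem hw (Subgroup.subset_closure (by simp))) i
        rw [LinearEquiv.mul_apply, apRho_two] at this
        push_cast
        exact this)
      push_cast at this
      rw [G3_vec] at this ⊢
      linarith
    push Not at h0 h1 h2
    rw [G3_vec]
    have key : 2 * (a ^ 2 + b ^ 2 + c ^ 2) - 4 * (a * b + a * c + b * c) ≤ 0 := by
      have e0 := mul_le_mul_of_nonneg_left h0 ha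
      have e1 := mul_le_mul_of_nonneg_left h1 hb
      have e2 := mul_le_mul_of_nonneg_left h2 hc
      linarith
    exact_mod_cast key

/-- If every element of the `W₃`-orbit of an integer vector `(a,b,c)` has all coordinates
nonnegative, then `G(a,b,c) ≤ 0`. -/
theorem orbit_nonneg_imp_G_nonpos (a b c : ℤ)
    (h : ∀ w ∈ apW3, ∀ i : Fin 3,
      0 ≤ (w : (Fin 3 → ℝ) ≃ₗ[ℝ] (Fin 3 → ℝ)) ![(a : ℝ), (b : ℝ), (c : ℝ)] i) :
    G3 ![(a : ℝ), (b : ℝ), (c : ℝ)] ≤ 0 := by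
  exact orbit_aux (a + b + c).toNat a b c (Int.self_le_toNat _) h
end
end

section
/- Let c ∈ ℝ⁴ be a base quadruple of a bounded Apollonian packing, and let s ∈ ℝ⁴ with sᵢ > 0 for all i. Then the family (exp(−⟨w·c, s⟩))_{w ∈ W}, indexed by the elements of the Apollonian group W, is summable. (That is, the generating function Z(s) of the packing converges absolutely on the simplicial cone C₀ = {s : all sᵢ > 0}.) -/
open Finset Complex

noncomputable section

/-- The Descartes quadratic form `F(x) = 2(x₁²+x₂²+x₃²+x₄²) − (x₁+x₂+x₃+x₄)²`. -/
def DescartesF (x : Fin 4 → ℝ) : ℝ := 2 * (∑ i, (x i)^2) - (∑ i, x i)^2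

/-- Height of a vector: the sum of its coordinates. -/
def ht (x : Fin 4 → ℝ) : ℝ := ∑ i, x i

/-- The Apollonian group `W`, generated by the four reflections `σ₁, σ₂, σ₃, σ₄`. -/
def apW : Subgroup ((Fin 4 → ℝ) ≃ₗ[ℝ] (Fin 4 → ℝ)) :=
  Subgroup.closure {apSigma 0, apSigma 1, apSigma 2, apSigma 3}

/-- The pairing `⟨x,s⟩ = x₁s₁+x₂s₂+x₃s₃+x₄s₄` of real vectors. -/
def pairR (x s : Fin 4 → ℝ) : ℝ := ∑ i, x i * s i

/-- `c` is a base quadruple of a bounded Apollonian packing: `F(c) = 0`, exactly one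
coordinate of `c` is negative, and `2cᵢ ≤ ht(c)` for every `i`. -/
def IsBaseQuadruple (c : Fin 4 → ℝ) : Prop :=
  DescartesF c = 0 ∧ (∃! i, c i < 0) ∧ ∀ i, 2 * c i ≤ ht c

/-- The product of reflections along a word. -/
def wordProd (l : List (Fin 4)) : (Fin 4 → ℝ) ≃ₗ[ℝ] (Fin 4 → ℝ) :=
  (l.map apSigma).prod

lemma apSigma_mul_self (i : Fin 4) : apSigma i * apSigma i = 1 := by
  ext x : 1
  exact sigmaL_invol i x

lemma red_step (i : Fin 4) (y : (Fin 4 → ℝ) ≃ₗ[ℝ] (Fin 4 → ℝ))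
    (h : ∃ l : List (Fin 4), l.IsChain (· ≠ ·) ∧ wordProd l = y) :
    ∃ l : List (Fin 4), l.IsChain (· ≠ ·) ∧ wordProd l = apSigma i * y := by
  obtain ⟨l, hl, rfl⟩ := h
  cases l with
  | nil => exact ⟨[i], by simp, by simp [wordProd]⟩
  | cons j t =>
    by_cases hij : i = j
    · subst hij
      refine ⟨t, hl.tail, ?_⟩
      simp only [wordProd, List.map_cons, List.prod_cons]
      rw [← mul_assoc, apSigma_mul_self, one_mul]
    · exact ⟨i :: j :: t, List.isChain_cons_cons.2 ⟨hij, hl⟩, by simp [wordProd]⟩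

lemma exists_red (w : (Fin 4 → ℝ) ≃ₗ[ℝ] (Fin 4 → ℝ)) (hw : w ∈ apW) :
    ∃ l : List (Fin 4), l.IsChain (· ≠ ·) ∧ wordProd l = w := by
  unfold apW at hw
  induction hw using Subgroup.closure_induction_left with
  | one => exact ⟨[], by simp, by simp [wordProd]⟩
  | mul_left x hx y hy ih =>
    obtain ⟨i, rfl⟩ : ∃ i, x = apSigma i := by
      rcases hx with rfl | rfl | rfl | rfl <;> exact ⟨_, rfl⟩
    exact red_step i y ih
  | inv_mul_cancel x hx y hy ih =>
    obtain ⟨i, rfl⟩ : ∃ i, x = apSigma i := by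
      rcases hx with rfl | rfl | rfl | rfl <;> exact ⟨_, rfl⟩
    rw [apSigma_inv]
    exact red_step i y ih

/-- The defect `ht(x) - 2 xⱼ`. -/
def dfc (x : Fin 4 → ℝ) (j : Fin 4) : ℝ := ht x - 2 * x j

lemma apSigma_apply (i : Fin 4) (x : Fin 4 → ℝ) :
    apSigma i x = Function.update x i (x i + 2 * dfc x i) := by
  have : apSigma i x = Function.update x i (2 * (∑ j, x j) - 3 * x i) := rfl
  rw [this]; congr 1; simp only [dfc, ht]; ring

lemma ht_apSigma (i : Fin 4) (x : Fin 4 → ℝ) : ht (apSigma i x) = ht x + 2 * dfc x i := by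
  rw [apSigma_apply]
  generalize dfc x i = d
  fin_cases i <;> simp [ht, Fin.sum_univ_four, Function.update] <;> ring

lemma pair_apSigma (i : Fin 4) (x s : Fin 4 → ℝ) :
    pairR (apSigma i x) s = pairR x s + 2 * dfc x i * s i := by
  rw [apSigma_apply]
  generalize dfc x i = d
  fin_cases i <;> simp [pairR, Fin.sum_univ_four, Function.update] <;> ring

lemma dfc_same (i : Fin 4) (x : Fin 4 → ℝ) : dfc (apSigma i x) i = - dfc x i := by
  conv_lhs => rw [dfc, ht_apSigma, apSigma_apply, Function.update_self]
  simp only [dfc]; ring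

lemma dfc_ne (i j : Fin 4) (h : j ≠ i) (x : Fin 4 → ℝ) :
    dfc (apSigma i x) j = dfc x j + 2 * dfc x i := by
  conv_lhs => rw [dfc, ht_apSigma, apSigma_apply, Function.update_of_ne h]
  simp only [dfc]; ring

lemma growth (c s : Fin 4 → ℝ) (δ m : ℝ) (hδ : 0 < δ) (hm : 0 < m) (hs : ∀ i, m ≤ s i)
    (h0 : ∀ i, 0 ≤ dfc c i) (h1 : ∀ i j, i ≠ j → δ ≤ dfc c i + dfc c j)
    (t : List (Fin 4)) : ∀ i, (i :: t).IsChain (· ≠ ·) →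
      t.length * δ ≤ - dfc (wordProd (i :: t) c) i ∧
      (∀ j, j ≠ i → - dfc (wordProd (i :: t) c) i + δ ≤ dfc (wordProd (i :: t) c) j) ∧
      pairR c s + m * δ * ((t.length + 1) * t.length) ≤ pairR (wordProd (i :: t) c) s := by
  induction t with
  | nil =>
    intro i _
    have e : wordProd [i] c = apSigma i c := by simp [wordProd]
    rw [e]
    refine ⟨?_, ?_, ?_⟩
    · rw [dfc_same]; simpa using h0 i
    · intro j hj
      rw [dfc_same, dfc_ne i j hj]
      linarith [h1 j i hj, h0 i]
    · rw [pair_apSigma]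
      have := mul_nonneg (h0 i) (hm.le.trans (hs i))
      simp only [List.length_nil, Nat.cast_zero]
      linarith
  | cons k t ih =>
    intro i hch
    obtain ⟨hik, hch'⟩ := List.isChain_cons_cons.1 hch
    obtain ⟨g1, g2, g3⟩ := ih k hch'
    have e : wordProd (i :: k :: t) c = apSigma i (wordProd (k :: t) c) := by
      simp [wordProd]
    rw [e]
    generalize wordProd (k :: t) c = y at *
    have hn : (0:ℝ) ≤ t.length * δ := by positivity
    have gi := g2 i hik
    refine ⟨?_, ?_, ?_⟩
    · rw [dfc_same]; push_cast [List.length_cons]; linarith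
    · intro j hj
      rw [dfc_same, dfc_ne i j hj]
      by_cases hjk : j = k
      · subst hjk; linarith
      · linarith [g2 j hjk]
    · rw [pair_apSigma]
      push_cast [List.length_cons]
      have hd : (t.length + 1) * δ ≤ dfc y i := by linarith
      have : ((t.length + 1) * δ) * m ≤ dfc y i * s i :=
        mul_le_mul hd (hs i) hm.le (le_trans (by positivity) hd)
      nlinarith

lemma base_pos (c : Fin 4 → ℝ) (hc : IsBaseQuadruple c) (i j : Fin 4) (h : i ≠ j) :
    0 < dfc c i + dfc c j := by
  obtain ⟨hF, ⟨n, hn, hu⟩, hle⟩ := hc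
  have h0 : ∀ i, 0 ≤ dfc c i := fun i => by have := hle i; unfold dfc; linarith
  by_contra hcon
  have hi : dfc c i = 0 := by linarith [h0 i, h0 j]
  have hj : dfc c j = 0 := by linarith [h0 i, h0 j]
  have hij : c i = c j := by unfold dfc at hi hj; linarith
  have key : ∀ k, k ≠ i → k ≠ j → c k = 0 := by
    intro k hki hkj
    have : c k ^ 2 = 0 := by
      clear hle h0 hu hn hcon hij
      simp only [dfc, ht, DescartesF, Fin.sum_univ_four] at hi hj hF
      fin_cases i <;> fin_cases j <;> fin_cases k <;> simp at h hki hkj <;> simp at hi hj ⊢ <;> grind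
    simpa using this
  have hni : n = i ∨ n = j := by
    by_contra hh
    push Not at hh
    have := key n hh.1 hh.2
    linarith
  rcases hni with rfl | rfl
  · exact h (hu j (by simpa [← hij] using hn)).symm
  · exact h (hu i (by simpa [hij] using hn))

lemma summable_seq (K : ℝ) (hK : 0 < K) :
    Summable fun n : ℕ => (4:ℝ) ^ n * Real.exp (-(K * (n * (n - 1)))) := by
  apply summable_of_ratio_test_tendsto_lt_one (l := 0) one_pos
  · exact Filter.Eventually.of_forall fun n => by positivity
  · have h : Filter.Tendsto (fun n : ℕ => 4 * Real.exp (-((2 * K) * n))) Filter.atTop (nhds (4 * 0)) := by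
      apply Filter.Tendsto.const_mul
      apply Real.tendsto_exp_neg_atTop_nhds_zero.comp
      exact tendsto_natCast_atTop_atTop.const_mul_atTop (by positivity)
    rw [mul_zero] at h
    refine h.congr fun n => ?_
    rw [Real.norm_of_nonneg (by positivity), Real.norm_of_nonneg (by positivity),
      eq_div_iff (by positivity), pow_succ]
    have : Real.exp (-(K * (((n + 1 : ℕ) : ℝ) * (((n + 1 : ℕ) : ℝ) - 1))))
        = Real.exp (-(2 * K * n)) * Real.exp (-(K * (n * (n - 1)))) := by
      rw [← Real.exp_add]; congr 1; push_cast; ring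
    rw [this]; ring

lemma summable_lists (K : ℝ) (hK : 0 < K) :
    Summable fun l : List (Fin 4) => Real.exp (-(K * (l.length * (l.length - 1)))) := by
  rw [← (Equiv.sigmaFiberEquiv (List.length : List (Fin 4) → ℕ)).summable_iff]
  have hft : ∀ n, Fintype {l : List (Fin 4) // l.length = n} := fun n =>
    inferInstanceAs (Fintype (List.Vector (Fin 4) n))
  have hcard : ∀ n, Fintype.card {l : List (Fin 4) // l.length = n} = 4 ^ n := fun n => by
    have := card_vector (α := Fin 4) n
    rw [Fintype.card_fin] at this
    rw [← this]
    exact Fintype.card_congr (Equiv.refl _)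
  rw [summable_sigma_of_nonneg (fun _ => by simp only [Function.comp]; positivity)]
  refine ⟨fun n => (hasSum_fintype _).summable, ?_⟩
  refine (summable_seq K hK).congr fun n => ?_
  rw [tsum_fintype]
  have : ∀ b : {l : List (Fin 4) // l.length = n},
    ((fun l : List (Fin 4) => Real.exp (-(K * (l.length * (l.length - 1))))) ∘
      (Equiv.sigmaFiberEquiv (List.length : List (Fin 4) → ℕ))) ⟨n, b⟩
      = Real.exp (-(K * (n * (n - 1)))) := by
    rintro ⟨l, rfl⟩
    rfl
  rw [Finset.sum_congr rfl (fun b _ => this b)]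
  rw [Finset.sum_const, Finset.card_univ, hcard]
  simp

/-- The generating function `Z(s)` of a bounded Apollonian packing converges absolutely
on the simplicial cone `C₀ = {s : all sᵢ > 0}`. -/
theorem summable_on_C0 (c : Fin 4 → ℝ) (hc : IsBaseQuadruple c)
    (s : Fin 4 → ℝ) (hs : ∀ i, 0 < s i) :
    Summable fun w : apW => Real.exp (-pairR ((w : (Fin 4 → ℝ) ≃ₗ[ℝ] (Fin 4 → ℝ)) c) s) := by
  have h0 : ∀ i, 0 ≤ dfc c i := fun i => by have := hc.2.2 i; unfold dfc; linarith
  obtain ⟨m, hm, hms⟩ : ∃ m : ℝ, 0 < m ∧ ∀ i, m ≤ s i := by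
    obtain ⟨i, hi⟩ := Finite.exists_min s
    exact ⟨s i, hs i, hi⟩
  obtain ⟨δ, hδ, h1⟩ : ∃ δ : ℝ, 0 < δ ∧ ∀ i j, i ≠ j → δ ≤ dfc c i + dfc c j := by
    have : Nonempty {p : Fin 4 × Fin 4 // p.1 ≠ p.2} := ⟨⟨(0, 1), by decide⟩⟩
    obtain ⟨p, hp⟩ := Finite.exists_min
      (fun p : {p : Fin 4 × Fin 4 // p.1 ≠ p.2} => dfc c p.1.1 + dfc c p.1.2)
    exact ⟨_, base_pos c hc _ _ p.2, fun i j hij => hp ⟨(i, j), hij⟩⟩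
  choose f hf1 hf2 using fun w : apW => exists_red w.1 w.2
  have hinj : Function.Injective f := fun a b hab => by
    apply Subtype.ext
    rw [← hf2 a, ← hf2 b, hab]
  have hS := ((summable_lists (m * δ) (by positivity)).mul_left
    (Real.exp (-pairR c s))).comp_injective hinj
  refine Summable.of_nonneg_of_le (fun w => (Real.exp_pos _).le) (fun w => ?_) hS
  simp only [Function.comp]
  rw [← Real.exp_add, Real.exp_le_exp]
  have hw := hf2 w
  have hch := hf1 w
  rw [← hw]
  generalize f w = l at *
  cases l with
  | nil => simp [wordProd]
  | cons i t =>
    have := (growth c s δ m hδ hm hms h0 h1 t i hch).2.2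
    push_cast [List.length_cons]
    have e : ((t.length : ℝ) + 1) * (t.length + 1 - 1) = (t.length + 1) * t.length := by ring
    rw [e]; linarith
end
end

section
/- Let s ∈ ℝ⁴. If for every w ∈ W* the vector w·s has exactly three positive coordinates and one negative coordinate, then ht(s) > 0. -/
open Finset Complex

noncomputable section

/-- The dual Apollonian reflection as a linear map: it sends `s` to the vector with `i`-th
coordinate `−sᵢ` and `j`-th coordinate `sⱼ + 2sᵢ` for `j ≠ i`. -/
def tauL (i : Fin 4) : (Fin 4 → ℝ) →ₗ[ℝ] (Fin 4 → ℝ) where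
  toFun s := fun j => if j = i then -s i else s j + 2 * s i
  map_add' x y := by
    funext j
    rcases eq_or_ne j i with h | h <;> simp [h] <;> ring
  map_smul' r x := by
    funext j
    rcases eq_or_ne j i with h | h <;> simp [h] <;> ring

lemma tauL_invol (i : Fin 4) : Function.Involutive (tauL i) := by
  intro x
  funext j
  rcases eq_or_ne j i with h | h <;> simp [tauL, h] <;> ring

/-- The dual Apollonian reflection `τᵢ` (the transpose of `σᵢ`) as a linear automorphism. -/
def apTau (i : Fin 4) : (Fin 4 → ℝ) ≃ₗ[ℝ] (Fin 4 → ℝ) :=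
  LinearEquiv.ofInvolutive (tauL i) (tauL_invol i)

/-- The dual Apollonian group `W* = ⟨τ₁, τ₂, τ₃, τ₄⟩`. -/
def apWstar : Subgroup ((Fin 4 → ℝ) ≃ₗ[ℝ] (Fin 4 → ℝ)) :=
  Subgroup.closure {apTau 0, apTau 1, apTau 2, apTau 3}

/-- Every point all of whose `W*`-translates have exactly three positive coordinates and
one negative coordinate has positive height. -/
theorem ht_pos_of_three_pos_one_neg (s : Fin 4 → ℝ)
    (h : ∀ w ∈ apWstar, ∃ i : Fin 4, (w : (Fin 4 → ℝ) ≃ₗ[ℝ] (Fin 4 → ℝ)) s i < 0 ∧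
      ∀ j : Fin 4, j ≠ i → 0 < (w : (Fin 4 → ℝ) ≃ₗ[ℝ] (Fin 4 → ℝ)) s j) :
    0 < ht s := by
  by_contra hn
  have hmem : ∀ i : Fin 4, apTau i ∈ apWstar := by
    intro i
    apply Subgroup.subset_closure
    fin_cases i <;> simp
  have hap : ∀ i j : Fin 4, apTau i s j = if j = i then -s i else s j + 2 * s i := fun _ _ => rfl
  obtain ⟨i, hi, hp⟩ := h 1 (Subgroup.one_mem _)
  simp only [LinearEquiv.coe_one, id] at hi hp
  obtain ⟨k, hk, hq⟩ := h (apTau i) (hmem i)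
  simp only [hap] at hk hq
  simp only [ht, Fin.sum_univ_four] at hn
  have p0 := hp 0
  have p1 := hp 1
  have p2 := hp 2
  have p3 := hp 3
  have q0 := hq 0
  have q1 := hq 1
  have q2 := hq 2
  have q3 := hq 3
  clear hp hq h
  fin_cases i <;> fin_cases k <;> simp at * <;> linarith
end
end

section
/- If s ∈ ℝ⁴ has all four coordinates nonnegative, then ht(w·s) ≥ 0 for every w ∈ W*. (Hence the Apollonian cone A = ⋃_{w∈W*} w(C) lies in the half-space ht(s) ≥ 0.) -/
open Finset Complex

noncomputable section

def sigA (j : Fin 4) (c : Fin 4 → ℝ) : Fin 4 → ℝ := fun k => if k = j then 2 * ht c - 3 * c j else c k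

lemma sigA_invol (j : Fin 4) (c : Fin 4 → ℝ) : sigA j (sigA j c) = c := by
  funext k
  fin_cases j <;> fin_cases k <;> simp [sigA, ht, Fin.sum_univ_four] <;> ring

inductive ReachA : Option (Fin 4) → (Fin 4 → ℝ) → Prop
  | base : ReachA none (fun _ => 1)
  | step (o : Option (Fin 4)) (c : Fin 4 → ℝ) (j : Fin 4) (h : ReachA o c) (hj : o ≠ some j) :
      ReachA (some j) (sigA j c)

lemma ReachA.sig {o : Option (Fin 4)} {c : Fin 4 → ℝ} (h : ReachA o c) (j : Fin 4) :
    ∃ o', ReachA o' (sigA j c) := by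
  by_cases hj : o = some j
  · subst hj
    cases h with
    | step o' c' _ h' _ => exact ⟨o', by rw [sigA_invol]; exact h'⟩
  · exact ⟨_, ReachA.step o c j h hj⟩

lemma ht_sigA (j : Fin 4) (c : Fin 4 → ℝ) : ht (sigA j c) = 3 * ht c - 4 * c j := by
  fin_cases j <;> simp [sigA, ht, Fin.sum_univ_four] <;> ring

lemma pair_le_ht (c : Fin 4 → ℝ) (hc : ∀ i, 0 ≤ c i) (j k : Fin 4) (h : k ≠ j) :
    c k + c j ≤ ht c := by
  have h0 := hc 0
  have h1 := hc 1
  have h2 := hc 2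
  have h3 := hc 3
  fin_cases j <;> fin_cases k <;> simp [ht, Fin.sum_univ_four] at h ⊢ <;> linarith

lemma ReachA.inv {o : Option (Fin 4)} {c : Fin 4 → ℝ} (h : ReachA o c) :
    (∀ i, 0 ≤ c i) ∧ ∀ j, o ≠ some j → 2 * c j ≤ ht c := by
  induction h with
  | base => exact ⟨fun _ => zero_le_one, fun j _ => by simp [ht]; norm_num⟩
  | step o c j h hj ih =>
    obtain ⟨h0, h1⟩ := ih
    have h2 := h1 j hj
    refine ⟨fun i => ?_, fun k hk => ?_⟩
    · have := h0 i
      have := h0 j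
      unfold sigA
      split_ifs <;> linarith
    · have hkj : k ≠ j := fun e => hk (by rw [e])
      have := pair_le_ht c h0 j k hkj
      rw [ht_sigA]
      simp only [sigA, if_neg hkj]
      linarith

lemma dual_tau (j : Fin 4) (c s : Fin 4 → ℝ) :
    ∑ i, c i * (apTau j s) i = ∑ i, sigA j c i * s i := by
  have : ∀ i, apTau j s i = if i = j then -s j else s i + 2 * s j := fun i => rfl
  simp only [this]
  fin_cases j <;> simp [sigA, ht, Fin.sum_univ_four] <;> ring

lemma apTau_inv (j : Fin 4) : (apTau j)⁻¹ = apTau j := by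
  rw [inv_eq_iff_mul_eq_one]
  ext1 s
  exact tauL_invol j s

lemma exists_reachA (w : (Fin 4 → ℝ) ≃ₗ[ℝ] (Fin 4 → ℝ)) (hw : w ∈ apWstar) :
    ∃ o c, ReachA o c ∧ ∀ s, ht (w s) = ∑ i, c i * s i := by
  have key : ∀ (x : (Fin 4 → ℝ) ≃ₗ[ℝ] (Fin 4 → ℝ)) (j : Fin 4),
      (∃ o c, ReachA o c ∧ ∀ s, ht (x s) = ∑ i, c i * s i) →
      ∃ o c, ReachA o c ∧ ∀ s, ht ((x * apTau j) s) = ∑ i, c i * s i := by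
    rintro x j ⟨o, c, h, hx⟩
    obtain ⟨o', h'⟩ := h.sig j
    exact ⟨o', _, h', fun s => by rw [← dual_tau, ← hx]; rfl⟩
  have gen : ∀ y ∈ ({apTau 0, apTau 1, apTau 2, apTau 3} :
      Set ((Fin 4 → ℝ) ≃ₗ[ℝ] (Fin 4 → ℝ))), ∃ j, y = apTau j := by
    rintro y (h | h | h | h)
    exacts [⟨_, h⟩, ⟨_, h⟩, ⟨_, h⟩, ⟨_, h⟩]
  unfold apWstar at hw
  induction hw using Subgroup.closure_induction_right with
  | one => exact ⟨_, _, ReachA.base, fun s => by simp [ht]⟩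
  | mul_right x hx y hy ih =>
    obtain ⟨j, rfl⟩ := gen y hy
    exact key x j ih
  | mul_inv_cancel x hx y hy ih =>
    obtain ⟨j, rfl⟩ := gen y hy
    rw [apTau_inv]
    exact key x j ih

/-- If `s` has all four coordinates nonnegative, then every `W*`-translate of `s` has
nonnegative height; hence the Apollonian cone lies in the half-space `ht(s) ≥ 0`. -/
theorem ht_nonneg_on_apollonian_cone (s : Fin 4 → ℝ) (hs : ∀ i, 0 ≤ s i) :
    ∀ w ∈ apWstar, 0 ≤ ht ((w : (Fin 4 → ℝ) ≃ₗ[ℝ] (Fin 4 → ℝ)) s) := by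
  intro w hw
  obtain ⟨o, c, h, hx⟩ := exists_reachA w hw
  rw [hx]
  exact Finset.sum_nonneg fun i _ => mul_nonneg (h.inv.1 i) (hs i)
end
end

section
/- Let s ∈ ℝ⁴ with F(s) < 0 and ht(s) > 0. Then there exists w ∈ W* such that w·s ∈ C, i.e. all four coordinates of w·s are nonnegative and at most one of them is zero. (The past timelike cone J⁻ of the Descartes form is contained in the Apollonian cone A; this is part of the geometric description A = J ∪ ⋃_{S∈𝒯} C_S.) -/
open Finset Complex

noncomputable section

/-- The set `C = {s ∈ ℝ⁴ : sᵢ ≥ 0 for all i, and at most one sᵢ = 0}`. -/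
def setC : Set (Fin 4 → ℝ) :=
  {s | (∀ i, 0 ≤ s i) ∧ ∀ i j, s i = 0 → s j = 0 → i = j}

lemma apTau_apply (i j : Fin 4) (s : Fin 4 → ℝ) :
    apTau i s j = if j = i then -s i else s j + 2 * s i := rfl

lemma apTau_mem (i : Fin 4) : apTau i ∈ apWstar := by
  apply Subgroup.subset_closure
  fin_cases i <;> simp

lemma F_tau (i : Fin 4) (s : Fin 4 → ℝ) : DescartesF (apTau i s) = DescartesF s := by
  fin_cases i <;> simp [DescartesF, apTau_apply, Fin.sum_univ_four] <;> ring

lemma ht_tau (i : Fin 4) (s : Fin 4 → ℝ) : ht (apTau i s) = ht s + 4 * s i := by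
  fin_cases i <;> simp [ht, apTau_apply, Fin.sum_univ_four] <;> ring

lemma F_pair (i j : Fin 4) (h : i ≠ j) (s : Fin 4 → ℝ) :
    -2 * (s i + s j) * (ht s - s i - s j) ≤ DescartesF s := by
  fin_cases i <;> fin_cases j <;> first | exact absurd rfl h | skip
  all_goals
    simp [DescartesF, ht, Fin.sum_univ_four]
    nlinarith [sq_nonneg (s 0 - s 1), sq_nonneg (s 2 - s 3), sq_nonneg (s 0 - s 2),
      sq_nonneg (s 1 - s 3), sq_nonneg (s 0 - s 3), sq_nonneg (s 1 - s 2)]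

lemma pair_sq (i j : Fin 4) (h : i ≠ j) (s : Fin 4 → ℝ) (hF : DescartesF s < 0) :
    (ht s - s i - s j) ^ 2 ≤ ht s ^ 2 := by
  have key : (ht s - s i - s j) ^ 2 ≤ 2 * ∑ i, (s i) ^ 2 := by
    fin_cases i <;> fin_cases j <;> first | exact absurd rfl h | skip
    all_goals
      simp [ht, Fin.sum_univ_four]
      nlinarith [sq_nonneg (s 0 - s 1), sq_nonneg (s 2 - s 3), sq_nonneg (s 0 - s 2),
        sq_nonneg (s 1 - s 3), sq_nonneg (s 0 - s 3), sq_nonneg (s 1 - s 2),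
        sq_nonneg (s 0), sq_nonneg (s 1), sq_nonneg (s 2), sq_nonneg (s 3)]
  unfold DescartesF at hF
  unfold ht at key ⊢
  linarith

lemma single_bound (i : Fin 4) (s : Fin 4 → ℝ) (hF : DescartesF s < 0) :
    8 * (s i) ^ 2 - 4 * s i * ht s < ht s ^ 2 := by
  fin_cases i <;> simp [DescartesF, ht, Fin.sum_univ_four] at * <;>
    nlinarith [sq_nonneg (s 0 - s 1), sq_nonneg (s 2 - s 3), sq_nonneg (s 0 - s 2),
      sq_nonneg (s 1 - s 3), sq_nonneg (s 0 - s 3), sq_nonneg (s 1 - s 2)]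

lemma ht_tau_pos (i : Fin 4) (s : Fin 4 → ℝ) (hF : DescartesF s < 0) (h : 0 < ht s) :
    0 < ht (apTau i s) := by
  rw [ht_tau]
  have := single_bound i s hF
  by_contra hc
  push Not at hc
  nlinarith

lemma descent (c T ε : ℝ) (hc : 0 < c) (hT : 0 < T) (hε : 0 < ε) (he : 8 * ε * T = c) (n : ℕ) :
    ∀ s : Fin 4 → ℝ, DescartesF s = -c → 0 < ht s → ht s ≤ T → ht s ≤ 4 * ε * n →
    ∃ w ∈ apWstar, (w : (Fin 4 → ℝ) ≃ₗ[ℝ] (Fin 4 → ℝ)) s ∈ setC := by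
  induction n with
  | zero => intro s _ h1 _ h2; simp at h2; linarith
  | succ n ih =>
    intro s hF hp hle hn
    have hneg : DescartesF s < 0 := by linarith
    by_cases h1 : ∃ i, s i < -ε
    · obtain ⟨i, hi⟩ := h1
      obtain ⟨w, hw, hws⟩ := ih (apTau i s) (by rw [F_tau, hF]) (ht_tau_pos i s hneg hp)
        (by rw [ht_tau]; linarith) (by rw [ht_tau]; push_cast at hn; linarith)
      exact ⟨w * apTau i, mul_mem hw (apTau_mem i), hws⟩
    push Not at h1
    by_cases h2 : ∃ i, s i < 0
    · obtain ⟨i, hi⟩ := h2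
      have hb : ∀ j, j ≠ i → 2 * ε < s j := by
        intro j hj
        by_contra hcon
        push Not at hcon
        have k1 := F_pair i j hj.symm s
        have k2 := abs_le_of_sq_le_sq (pair_sq i j hj.symm s hneg) hp.le
        have k3 : |s i + s j| ≤ 2 * ε := abs_le.2 ⟨by linarith [h1 i, h1 j], by linarith⟩
        have k4 : |(s i + s j) * (ht s - s i - s j)| ≤ 2 * ε * T := by
          rw [abs_mul]
          exact mul_le_mul k3 (k2.trans hle) (abs_nonneg _) (by linarith)
        have k5 := (abs_le.1 k4).2
        nlinarith
      have hpos : ∀ j, 0 < apTau i s j := by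
        intro j
        rw [apTau_apply]
        split_ifs with h
        · linarith
        · linarith [hb j h, h1 i]
      exact ⟨apTau i, apTau_mem i, fun j => (hpos j).le, fun j k h _ => absurd h (hpos j).ne'⟩
    · push Not at h2
      refine ⟨1, one_mem _, h2, ?_⟩
      intro i j hi hj
      by_contra hij
      have k := F_pair i j hij s
      have hi' : s i = 0 := hi
      have hj' : s j = 0 := hj
      rw [hi', hj'] at k
      simp at k
      linarith

/-- The past timelike cone `J⁻` of the Descartes form is contained in the Apollonian
cone `A = ⋃_{w ∈ W*} w(C)`. -/
theorem timelike_past_subset_apollonian_cone (s : Fin 4 → ℝ)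
    (hF : DescartesF s < 0) (hht : 0 < ht s) :
    ∃ w ∈ apWstar, (w : (Fin 4 → ℝ) ≃ₗ[ℝ] (Fin 4 → ℝ)) s ∈ setC := by
  obtain ⟨n, hn⟩ := exists_nat_ge (ht s / (4 * (-DescartesF s / (8 * ht s))))
  have hε : 0 < -DescartesF s / (8 * ht s) := div_pos (by linarith) (by linarith)
  refine descent (-DescartesF s) (ht s) (-DescartesF s / (8 * ht s)) (by linarith) hht hε
    (by field_simp) n s (by ring) hht le_rfl ?_
  rw [div_le_iff₀ (by linarith)] at hn
  linarith
end
end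

section
/- Let s ∈ ℝ⁴ with all four coordinates nonnegative and F(s) > 0. Then there exists i ∈ {1,2,3,4} such that 2sᵢ ≥ ht(s) and (2sᵢ − ht(s))² ≥ F(s). (Every point of the fundamental simplex C̄ that lies outside the timelike cone J lies in one of the four bounded cones tangent to the light cone N with apexes at the fundamental weights ω₁,…,ω₄; this is part of the proof that the faces and interior of each simplex w(C̄) lie in the union of J with the four cones of a Descartes quadruple.) -/
open Finset Complex

noncomputable section

/-- Every point of the fundamental simplex lying outside the timelike cone lies in one of
the four bounded cones tangent to the light cone with apexes at the fundamental weights. -/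
theorem fundamental_simplex_covered_by_cones (s : Fin 4 → ℝ)
    (hs : ∀ i, 0 ≤ s i) (hF : 0 < DescartesF s) :
    ∃ i : Fin 4, ht s ≤ 2 * s i ∧ DescartesF s ≤ (2 * s i - ht s)^2 := by
  have key : ∃ i : Fin 4, ht s ≤ 2 * s i := by
    by_contra! h
    have hh : ∀ i, 0 ≤ s i * (ht s - 2 * s i) := fun i =>
      mul_nonneg (hs i) (sub_nonneg.2 (h i).le)
    have h0 := hh 0
    have h1 := hh 1
    have h2 := hh 2
    have h3 := hh 3
    simp only [DescartesF, ht, Fin.sum_univ_four] at *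
    nlinarith
  obtain ⟨i, hi⟩ := key
  refine ⟨i, hi, ?_⟩
  have h01 := mul_nonneg (hs 0) (hs 1)
  have h02 := mul_nonneg (hs 0) (hs 2)
  have h03 := mul_nonneg (hs 0) (hs 3)
  have h12 := mul_nonneg (hs 1) (hs 2)
  have h13 := mul_nonneg (hs 1) (hs 3)
  have h23 := mul_nonneg (hs 2) (hs 3)
  clear hi
  simp only [DescartesF, ht, Fin.sum_univ_four]
  fin_cases i <;> simp <;> nlinarith
end
end

section
/- For all i ≠ j in {1,2,3,4}, the solution set { s ∈ ℝ⁴ : F(s) = 0, ht(s) = 2sᵢ, and ht(s) = 2sⱼ } equals the line { t(eᵢ + eⱼ) : t ∈ ℝ }, where eᵢ, eⱼ are standard basis vectors. (Hence the four planes ht(s) = 2sᵢ intersect the light cone N = {F = 0} in four mutually tangent circles, each pair meeting in a single projective point.) -/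
open Finset Complex

noncomputable section

theorem tangency_aux (a b c d : ℝ) (hF : 2 * (a^2+b^2+c^2+d^2) - (a+b+c+d)^2 = 0)
    (h1 : a+b+c+d = 2*a) (h2 : a+b+c+d = 2*b) : b = a ∧ c = 0 ∧ d = 0 := by
  have hb : b = a := by linarith
  have hd : d = -c := by linarith
  subst hb hd
  have hc : c ^ 2 = 0 := by nlinarith
  have : c = 0 := by simpa using hc
  simp [this]

/-- For `i ≠ j`, the plane sections `ht(s) = 2sᵢ`, `ht(s) = 2sⱼ` of the light cone
`{F = 0}` meet exactly in the line through `eᵢ + eⱼ`. -/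
theorem tangency_line (i j : Fin 4) (hij : i ≠ j) :
    {s : Fin 4 → ℝ | DescartesF s = 0 ∧ ht s = 2 * s i ∧ ht s = 2 * s j} =
      {s : Fin 4 → ℝ | ∃ t : ℝ,
        s = t • (Pi.single i (1 : ℝ) + Pi.single j (1 : ℝ))} := by
  ext s
  simp only [Set.mem_setOf_eq, DescartesF, ht, Fin.sum_univ_four]
  constructor
  · rintro ⟨hF, h1, h2⟩
    refine ⟨s i, ?_⟩
    have key : ∀ k l : Fin 4, k ≠ i → k ≠ j → l ≠ i → l ≠ j → k ≠ l →
        s j = s i ∧ s k = 0 ∧ s l = 0 := by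
      intro k l hki hkj hli hlj hkl
      have hs : ∀ f : Fin 4 → ℝ, f 0 + f 1 + f 2 + f 3 = f i + f j + f k + f l := by
        intro f
        fin_cases i <;> fin_cases j <;> first | exact absurd rfl hij | skip
        all_goals
          fin_cases k <;> first | exact absurd rfl hki | exact absurd rfl hkj | skip
        all_goals
          fin_cases l <;> first
            | exact absurd rfl hli | exact absurd rfl hlj | exact absurd rfl hkl
            | (dsimp; done)
            | (dsimp; ring)
      have e2 := hs (fun m => s m ^ 2)
      rw [e2, hs s] at hF
      rw [hs s] at h1 h2
      exact tangency_aux _ _ _ _ hF h1 h2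
    have hex : ∀ i j k : Fin 4, i ≠ j → k ≠ i → k ≠ j →
        ∃ l : Fin 4, l ≠ i ∧ l ≠ j ∧ k ≠ l := by decide
    have hex2 : ∀ i j : Fin 4, ∃ k : Fin 4, k ≠ i ∧ k ≠ j := by decide
    have hji : s j = s i := by
      obtain ⟨k, hki, hkj⟩ := hex2 i j
      obtain ⟨l, hli, hlj, hkl⟩ := hex i j k hij hki hkj
      exact (key k l hki hkj hli hlj hkl).1
    funext k
    by_cases hki : k = i
    · subst hki; simp [hij]
    by_cases hkj : k = j
    · subst hkj; simp [hki, hji]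
    obtain ⟨l, hli, hlj, hkl⟩ := hex i j k hij hki hkj
    simp [hki, hkj, (key k l hki hkj hli hlj hkl).2.1]
  · rintro ⟨t, rfl⟩
    fin_cases i <;> fin_cases j <;> first
      | exact absurd rfl hij
      | (simp [Pi.single_apply]; try (constructor <;> ring_nf))
      | (simp [Pi.single_apply]; ring_nf; try simp)
end
end
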